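/- Let n ≥ 1 be an integer, let H : ℝ³ → ℝ be a harmonic polynomial (ΔH = 0) homogeneous of degree n, let Pₙ denote the n-th Legendre polynomial, and set Q_{n+1}(s) = ∫₁ˢ Pₙ(y) dy. Let ω : ℝ → ℝ be smooth. Define v(x,t) = H(x/|x|) · ∫₀^{t+1−|x|} ω(τ) Q_{n+1}((t+1−τ)/|x|) dτ for t ≥ |x| − 1 and v(x,t) = 0 for t < |x| − 1. Then: (i) v satisfies the wave equation ∂ₜₜv − Δv = 0 on the open region {(x,t) : |x| > 1, t > |x| − 1}; (ii) v(x,0) = 0 and ∂ₜv(x,0) = 0 for |x| > 1; and (iii) for |x| = 1 and t > 0, v(x,t) = H(x) · ∫₀ᵗ ω(τ) Q_{n+1}(t+1−τ) dτ. -/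

import Mathlib

noncomputable section

/-- The spatial Laplacian of `f : ℝ³ → ℝ` at `x`. -/
def lap3 (f : EuclideanSpace ℝ (Fin 3) → ℝ) (x : EuclideanSpace ℝ (Fin 3)) : ℝ :=
  ∑ k : Fin 3, iteratedDeriv 2 (fun s : ℝ => f (x + s • EuclideanSpace.single k (1:ℝ))) 0

/-- The `n`-th Legendre polynomial via Rodrigues' formula. -/
def legendreFn (n : ℕ) (y : ℝ) : ℝ :=
  (1 / (2 ^ n * n.factorial)) * iteratedDeriv n (fun z : ℝ => (z ^ 2 - 1) ^ n) y

/-- `Q_{n+1}(s) = ∫₁ˢ Pₙ(y) dy`. -/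
def Qfun (n : ℕ) (s : ℝ) : ℝ := ∫ y in (1:ℝ)..s, legendreFn n y

open Polynomial

/-- Rodrigues' formula for the Legendre polynomial, as a formal polynomial. -/
def legendrePoly (n : ℕ) : ℝ[X] :=
  C (1 / (2 ^ n * (n.factorial : ℝ))) * derivative^[n] ((X ^ 2 - 1) ^ n)

theorem legendreFn_eq_eval (n : ℕ) (y : ℝ) : legendreFn n y = (legendrePoly n).eval y := by
  have h : (fun z : ℝ => (z ^ 2 - 1) ^ n) = fun z => ((X ^ 2 - 1 : ℝ[X]) ^ n).eval z := by
    funext z; simp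
  have h2 : ∀ (m : ℕ) (p : ℝ[X]),
      iteratedDeriv m (fun z => p.eval z) = fun z => (derivative^[m] p).eval z := by
    intro m
    induction m with
    | zero => intro p; simp
    | succ m ih =>
      intro p
      rw [iteratedDeriv_succ, ih]
      funext z
      rw [Polynomial.deriv, Function.iterate_succ_apply']
  rw [legendreFn, legendrePoly, h, h2]
  simp

theorem iterate_derivative_quadratic (a : ℝ) (g : ℝ[X]) (m : ℕ) :
    derivative^[m + 1] ((X ^ 2 - 1) * derivative g - C (2 * a) * X * g) =
      (X ^ 2 - 1) * derivative^[m + 2] g + C (2 * (m + 1 - a)) * X * derivative^[m + 1] g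
        + C ((m + 1) * (m - 2 * a)) * derivative^[m] g := by
  induction m with
  | zero =>
    simp [Function.iterate_succ_apply', C_ofNat]
    ring
  | succ m ih =>
    rw [Function.iterate_succ_apply', ih]
    simp [Function.iterate_succ_apply', derivative_mul, C_ofNat]
    ring

theorem legendrePoly_ode (n : ℕ) :
    derivative ((X ^ 2 - 1) * derivative (legendrePoly n)) =
      C ((n : ℝ) * (n + 1)) * legendrePoly n := by
  have h0 : (X ^ 2 - 1) * derivative ((X ^ 2 - 1 : ℝ[X]) ^ n)
      - C (2 * (n : ℝ)) * X * (X ^ 2 - 1) ^ n = 0 := by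
    rcases n with _ | n
    · simp
    · simp [derivative_pow]
      ring
  have h := iterate_derivative_quadratic n ((X ^ 2 - 1 : ℝ[X]) ^ n) n
  rw [h0, iterate_derivative_zero] at h
  rw [legendrePoly]
  generalize (X ^ 2 - 1 : ℝ[X]) ^ n = w at h ⊢
  generalize 1 / (2 ^ n * (n.factorial : ℝ)) = c
  simp only [Function.iterate_succ_apply'] at h
  simp [derivative_mul, C_ofNat] at h ⊢
  linear_combination (-C c) * h

theorem exists_shifted_Qfun_polynomial (n : ℕ) (hn : 1 ≤ n) :
    ∃ p : ℝ[X], p.eval 0 = 0 ∧ (∀ u, Qfun n (1 + u) = p.eval u) ∧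
      (X ^ 2 + 2 * X) * derivative (derivative p) = C ((n : ℝ) * (n + 1)) * p := by
  have hc : (n : ℝ) * (n + 1) ≠ 0 := by positivity
  set c := (n : ℝ) * (n + 1)
  set q : ℝ[X] := C c⁻¹ * ((X ^ 2 - 1) * derivative (legendrePoly n)) with hq
  have hq' : derivative q = legendrePoly n := by
    rw [hq, derivative_C_mul, legendrePoly_ode, ← mul_assoc, ← C_mul, inv_mul_cancel₀ hc]
    simp
  have hq'' : (X ^ 2 - 1) * derivative (derivative q) = C c * q := by
    rw [hq', hq, ← mul_assoc (C c), ← C_mul, mul_inv_cancel₀ hc]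
    simp
  have hq1 : q.eval 1 = 0 := by simp [hq]
  refine ⟨q.comp (X + 1), by simpa using hq1, fun u => ?_, ?_⟩
  · have : ∀ y ∈ Set.uIcc (1 : ℝ) (1 + u), HasDerivAt (fun z => q.eval z) (legendreFn n y) y := by
      intro y _
      rw [legendreFn_eq_eval, ← hq']
      exact q.hasDerivAt y
    rw [Qfun, intervalIntegral.integral_eq_sub_of_hasDerivAt this]
    · simp [hq1, add_comm]
    · refine Continuous.intervalIntegrable ?_ _ _
      simp_rw [funext (legendreFn_eq_eval n)]
      exact (legendrePoly n).continuous
  · have h := congrArg (fun f : ℝ[X] => f.comp (X + 1)) hq''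
    simp [derivative_comp] at h ⊢
    linear_combination h

theorem hasDerivAt_integral_mul_sub_pow {ω : ℝ → ℝ} (hω : Continuous ω) (k : ℕ) (a : ℝ) :
    HasDerivAt (fun a => ∫ τ in (0 : ℝ)..a, ω τ * (a - τ) ^ k)
      (ω a * 0 ^ k + k * ∫ τ in (0 : ℝ)..a, ω τ * (a - τ) ^ (k - 1)) a := by
  induction k generalizing ω with
  | zero => simpa using hω.integral_hasStrictDerivAt 0 a |>.hasDerivAt
  | succ k ih =>
    have hsplit : ∀ (j : ℕ) (a : ℝ), ∫ τ in (0 : ℝ)..a, ω τ * (a - τ) ^ (j + 1) =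
        a * (∫ τ in (0 : ℝ)..a, ω τ * (a - τ) ^ j)
          - ∫ τ in (0 : ℝ)..a, (τ * ω τ) * (a - τ) ^ j := by
      intro j a
      rw [← intervalIntegral.integral_const_mul, ← intervalIntegral.integral_sub]
      · congr 1; funext τ; ring
      all_goals apply Continuous.intervalIntegrable; fun_prop
    simp only [hsplit k]
    refine (((hasDerivAt_id a).fun_mul (ih hω)).fun_sub
      (ih (ω := fun τ => τ * ω τ) (by fun_prop))).congr_deriv ?_
    rcases k with _ | k
    · simp
    · simp only [id, Nat.add_sub_cancel, hsplit k]
      push_cast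
      ring

/-- The convolution of `ω` with the polynomial kernel `u ↦ p (u / r)` on `[0, a]`. -/
def polyConv (ω : ℝ → ℝ) (p : ℝ[X]) (r a : ℝ) : ℝ :=
  ∫ τ in (0 : ℝ)..a, ω τ * p.eval ((a - τ) / r)

theorem polyConv_add {ω : ℝ → ℝ} (hω : Continuous ω) (p q : ℝ[X]) (r a : ℝ) :
    polyConv ω (p + q) r a = polyConv ω p r a + polyConv ω q r a := by
  simp only [polyConv, eval_add, mul_add]
  apply intervalIntegral.integral_add <;> apply Continuous.intervalIntegrable <;> fun_prop

theorem polyConv_C_mul (ω : ℝ → ℝ) (c : ℝ) (p : ℝ[X]) (r a : ℝ) :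
    polyConv ω (C c * p) r a = c * polyConv ω p r a := by
  simp only [polyConv, eval_mul, eval_C, ← intervalIntegral.integral_const_mul]
  congr 1; funext τ; ring

theorem polyConv_X_pow (ω : ℝ → ℝ) (k : ℕ) (r a : ℝ) :
    polyConv ω (X ^ k) r a = (r ^ k)⁻¹ * ∫ τ in (0 : ℝ)..a, ω τ * (a - τ) ^ k := by
  simp only [polyConv, eval_pow, eval_X, ← intervalIntegral.integral_const_mul]
  congr 1; funext τ; rw [div_pow]; ring

theorem hasDerivAt_polyConv {ω : ℝ → ℝ} (hω : Continuous ω) (p : ℝ[X]) {r a : ℝ → ℝ}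
    {r' a' s : ℝ} (hr : HasDerivAt r r' s) (ha : HasDerivAt a a' s) (h0 : r s ≠ 0) :
    HasDerivAt (fun s => polyConv ω p (r s) (a s))
      (a' * (ω (a s) * p.eval 0 + polyConv ω (derivative p) (r s) (a s) / r s)
        - r' / r s * polyConv ω (X * derivative p) (r s) (a s)) s := by
  induction p using Polynomial.induction_on' with
  | add p q hp hq =>
    simp only [derivative_add, mul_add, polyConv_add hω, eval_add]
    exact (hp.fun_add hq).congr_deriv (by ring)
  | monomial k c =>
    rw [← C_mul_X_pow_eq_monomial]
    simp only [derivative_C_mul, polyConv_C_mul, mul_left_comm X (C _), eval_mul, eval_C]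
    have hG := (hasDerivAt_integral_mul_sub_pow hω k (a s)).comp s ha
    have hrk := (hr.fun_pow k).fun_inv (pow_ne_zero k h0)
    have h := (hrk.fun_mul hG).const_mul c
    have hXk : X * derivative (X ^ k : ℝ[X]) = C (k : ℝ) * X ^ k := by
      rcases k with _ | k
      · simp
      · simp; ring
    have hdk : derivative (X ^ k : ℝ[X]) = C (k : ℝ) * X ^ (k - 1) := derivative_X_pow k
    rw [hXk, hdk]
    simp only [polyConv_C_mul, polyConv_X_pow]
    refine h.congr_deriv ?_
    rcases k with _ | k
    · simp
      ring
    · simp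
      field_simp
      ring

theorem iteratedDeriv_two_eq {g g₁ : ℝ → ℝ} {g₂ s : ℝ}
    (h1 : ∀ᶠ y in nhds s, HasDerivAt g (g₁ y) y) (h2 : HasDerivAt g₁ g₂ s) :
    iteratedDeriv 2 g s = g₂ := by
  rw [iteratedDeriv_succ, iteratedDeriv_one]
  have : deriv g =ᶠ[nhds s] g₁ := h1.mono fun y hy => hy.deriv
  rw [this.deriv_eq, h2.deriv]

theorem hasDerivAt_eval_add_smul_single (P : MvPolynomial (Fin 3) ℝ)
    (x : EuclideanSpace ℝ (Fin 3)) (k : Fin 3) (s : ℝ) :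
    HasDerivAt (fun s : ℝ => MvPolynomial.eval ⇑(x + s • EuclideanSpace.single k (1 : ℝ)) P)
      (MvPolynomial.eval ⇑(x + s • EuclideanSpace.single k (1 : ℝ)) (MvPolynomial.pderiv k P)) s := by
  induction P using MvPolynomial.induction_on with
  | C a => simpa using hasDerivAt_const s a
  | add p q hp hq => simpa using hp.fun_add hq
  | mul_X p i hp =>
    have hX : HasDerivAt (fun s : ℝ => (x + s • EuclideanSpace.single k (1 : ℝ)) i)
        (if i = k then 1 else 0) s := by
      simpa [PiLp.single_apply] using
        ((hasDerivAt_id s).mul_const (if i = k then (1 : ℝ) else 0)).const_add (x i)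
    simp only [map_mul, MvPolynomial.eval_X]
    refine (hp.fun_mul hX).congr_deriv ?_
    rw [Derivation.leibniz, MvPolynomial.pderiv_X]
    rcases eq_or_ne i k with rfl | h
    · simp
      ring
    · simp [h]
      ring

theorem hasDerivAt_norm_add_smul_single (x : EuclideanSpace ℝ (Fin 3)) (k : Fin 3) (s : ℝ)
    (h : x + s • EuclideanSpace.single k (1 : ℝ) ≠ 0) :
    HasDerivAt (fun s : ℝ => ‖x + s • EuclideanSpace.single k (1 : ℝ)‖)
      ((x k + s) / ‖x + s • EuclideanSpace.single k (1 : ℝ)‖) s := by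
  have h1 : HasDerivAt (fun s : ℝ => x + s • EuclideanSpace.single k (1 : ℝ))
      (EuclideanSpace.single k (1 : ℝ)) s := by
    simpa using ((hasDerivAt_id s).smul_const (EuclideanSpace.single k (1 : ℝ))).const_add x
  have h2 := h1.norm_sq.sqrt (by positivity)
  simp only [Real.sqrt_sq (norm_nonneg _)] at h2
  refine h2.congr_deriv ?_
  simp [EuclideanSpace.inner_single_right]
  field_simp

theorem MvPolynomial.IsHomogeneous.eval_smul_eq {σ : Type*} [Fintype σ] {n : ℕ}
    {P : MvPolynomial σ ℝ} (hP : P.IsHomogeneous n) (c : ℝ) (x : σ → ℝ) :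
    MvPolynomial.eval (c • x) P = c ^ n * MvPolynomial.eval x P := by
  rw [MvPolynomial.eval_eq', MvPolynomial.eval_eq', Finset.mul_sum]
  refine Finset.sum_congr rfl fun d hd => ?_
  have hdeg : ∑ i, d i = n := by
    rw [← hP (MvPolynomial.mem_support_iff.1 hd), Finsupp.weight_apply,
      Finsupp.sum_fintype _ _ (by simp)]
    simp
  simp only [Pi.smul_apply, smul_eq_mul, mul_pow, Finset.prod_mul_distrib,
    Finset.prod_pow_eq_pow_sum, hdeg]
  ring

/-- The Laplacian of a homogeneous harmonic polynomial times a radial function. -/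
theorem lap3_harmonic_mul_radial {n : ℕ} {H : EuclideanSpace ℝ (Fin 3) → ℝ}
    {P : MvPolynomial (Fin 3) ℝ} (hP : P.IsHomogeneous n)
    (hHP : ∀ x : EuclideanSpace ℝ (Fin 3), H x = MvPolynomial.eval x P)
    (hHharm : ∀ x : EuclideanSpace ℝ (Fin 3), lap3 H x = 0)
    {f f₁ : ℝ → ℝ} {f₂ : ℝ} {x : EuclideanSpace ℝ (Fin 3)} (hx : x ≠ 0)
    (hf : ∀ᶠ r in nhds ‖x‖, HasDerivAt f (f₁ r) r) (hf₁ : HasDerivAt f₁ f₂ ‖x‖) :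
    lap3 (fun y => H y * f ‖y‖) x = H x * (f₂ + (2 * n + 2) / ‖x‖ * f₁ ‖x‖) := by
  have hr : 0 < ‖x‖ := norm_pos_iff.2 hx
  have euler : ∑ k : Fin 3, x k * MvPolynomial.eval x (MvPolynomial.pderiv k P) = n * H x := by
    have := congrArg (MvPolynomial.eval x) hP.sum_X_mul_pderiv
    simpa [hHP] using this
  have harm : ∑ k : Fin 3, MvPolynomial.eval x
      (MvPolynomial.pderiv k (MvPolynomial.pderiv k P)) = 0 := by
    rw [← hHharm x, lap3]
    refine Finset.sum_congr rfl fun k _ => ?_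
    have h2 := hasDerivAt_eval_add_smul_single (MvPolynomial.pderiv k P) x k 0
    simp only [zero_smul, add_zero] at h2
    refine (iteratedDeriv_two_eq (Filter.Eventually.of_forall fun s => ?_) h2).symm
    simpa only [hHP] using hasDerivAt_eval_add_smul_single P x k s
  have hnorm : ∑ k : Fin 3, x k ^ 2 = ‖x‖ ^ 2 := by
    simp [EuclideanSpace.norm_sq_eq]
  have key : ∀ k : Fin 3, iteratedDeriv 2 (fun s : ℝ =>
      H (x + s • EuclideanSpace.single k (1:ℝ)) * f ‖x + s • EuclideanSpace.single k (1:ℝ)‖) 0 =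
      MvPolynomial.eval x (MvPolynomial.pderiv k (MvPolynomial.pderiv k P)) * f ‖x‖
      + 2 * f₁ ‖x‖ / ‖x‖ * (x k * MvPolynomial.eval x (MvPolynomial.pderiv k P))
      + H x * (f₂ / ‖x‖ ^ 2 * x k ^ 2 + f₁ ‖x‖ * (1 / ‖x‖ - x k ^ 2 / ‖x‖ ^ 3)) := by
    intro k
    have hc : Filter.Tendsto (fun s : ℝ => ‖x + s • EuclideanSpace.single k (1 : ℝ)‖) (nhds 0)
        (nhds ‖x‖) := by
      have : Continuous (fun s : ℝ => ‖x + s • EuclideanSpace.single k (1 : ℝ)‖) := by fun_prop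
      simpa using this.tendsto 0
    have h1 : ∀ᶠ s in nhds (0 : ℝ), HasDerivAt (fun s : ℝ =>
        H (x + s • EuclideanSpace.single k (1:ℝ)) * f ‖x + s • EuclideanSpace.single k (1:ℝ)‖)
        (MvPolynomial.eval ⇑(x + s • EuclideanSpace.single k (1 : ℝ)) (MvPolynomial.pderiv k P)
          * f ‖x + s • EuclideanSpace.single k (1:ℝ)‖
          + MvPolynomial.eval ⇑(x + s • EuclideanSpace.single k (1 : ℝ)) P
          * (f₁ ‖x + s • EuclideanSpace.single k (1:ℝ)‖ *
            ((x k + s) / ‖x + s • EuclideanSpace.single k (1 : ℝ)‖))) s := by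
      filter_upwards [hc.eventually hf, hc.eventually (lt_mem_nhds hr)] with s hs hs0
      simp only [hHP]
      exact (hasDerivAt_eval_add_smul_single P x k s).fun_mul
        (hs.comp s (hasDerivAt_norm_add_smul_single x k s (norm_pos_iff.1 hs0)))
    have hn0 := hasDerivAt_norm_add_smul_single x k 0 (by simpa using hx)
    have hE0 := hasDerivAt_eval_add_smul_single P x k 0
    have hE1 := hasDerivAt_eval_add_smul_single (MvPolynomial.pderiv k P) x k 0
    have hx0 : x + (0 : ℝ) • EuclideanSpace.single k (1 : ℝ) = x := by simp
    have hfx := hf.self_of_nhds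
    rw [← hx0] at hfx hf₁
    have h2 := (hE1.mul (hfx.comp 0 hn0)).add (hE0.mul ((hf₁.comp 0 hn0).mul
      (((hasDerivAt_id (0 : ℝ)).const_add (x k)).div hn0 (by simpa using hx))))
    refine (iteratedDeriv_two_eq h1 h2).trans ?_
    simp [hHP]
    field_simp
    ring
  simp only [lap3, key, Finset.sum_add_distrib, ← Finset.sum_mul, ← Finset.mul_sum,
    Finset.sum_sub_distrib, ← Finset.sum_div, harm, euler, hnorm]
  simp
  field_simp
  ring

theorem hasDerivAt_polyConv_time {ω : ℝ → ℝ} (hω : Continuous ω) (p : ℝ[X]) {r : ℝ}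
    (hr : r ≠ 0) (t : ℝ) :
    HasDerivAt (fun t => polyConv ω p r (t + 1 - r))
      (ω (t + 1 - r) * p.eval 0 + polyConv ω (derivative p) r (t + 1 - r) / r) t := by
  simpa using hasDerivAt_polyConv hω p (hasDerivAt_const t r)
    (((hasDerivAt_id t).add_const 1).sub_const r) hr

theorem hasDerivAt_polyConv_radius {ω : ℝ → ℝ} (hω : Continuous ω) (p : ℝ[X]) {r : ℝ}
    (hr : r ≠ 0) (t : ℝ) :
    HasDerivAt (fun r => polyConv ω p r (t + 1 - r))
      (-(ω (t + 1 - r) * p.eval 0) - polyConv ω ((X + 1) * derivative p) r (t + 1 - r) / r) r := by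
  refine (hasDerivAt_polyConv hω p (hasDerivAt_id r) ((hasDerivAt_id r).const_sub (t + 1))
    hr).congr_deriv ?_
  simp only [add_mul, one_mul, polyConv_add hω, id]
  ring
/-- For a harmonic polynomial `H` homogeneous of degree `n ≥ 1` and any smooth `ω`, the
function `v(x,t) = H(x/|x|) ∫₀^{t+1−|x|} ω(τ) Q_{n+1}((t+1−τ)/|x|) dτ` for `t ≥ |x|−1`
(and `v = 0` otherwise) solves the wave equation in `{|x| > 1, t > |x|−1}`, has zero
Cauchy data at `t = 0` for `|x| > 1`, and on `|x| = 1`, `t > 0` takes the boundary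
values `H(x) ∫₀ᵗ ω(τ) Q_{n+1}(t+1−τ) dτ`. -/
theorem statement6
    (n : ℕ) (hn : 1 ≤ n)
    (H : EuclideanSpace ℝ (Fin 3) → ℝ)
    (hHpoly : ∃ P : MvPolynomial (Fin 3) ℝ, P.IsHomogeneous n ∧
      ∀ x : EuclideanSpace ℝ (Fin 3), H x = MvPolynomial.eval x P)
    (hHharm : ∀ x : EuclideanSpace ℝ (Fin 3), lap3 H x = 0)
    (ω : ℝ → ℝ) (hω : ContDiff ℝ (⊤ : ℕ∞) ω)
    (v : EuclideanSpace ℝ (Fin 3) → ℝ → ℝ)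
    (hv : ∀ (x : EuclideanSpace ℝ (Fin 3)) (t : ℝ),
      v x t = if ‖x‖ - 1 ≤ t then
          H (‖x‖⁻¹ • x) * ∫ τ in (0:ℝ)..(t + 1 - ‖x‖), ω τ * Qfun n ((t + 1 - τ) / ‖x‖)
        else 0) :
    (∀ (x : EuclideanSpace ℝ (Fin 3)) (t : ℝ), 1 < ‖x‖ → ‖x‖ - 1 < t →
      iteratedDeriv 2 (fun s => v x s) t - lap3 (fun y => v y t) x = 0) ∧
    (∀ x : EuclideanSpace ℝ (Fin 3), 1 < ‖x‖ →
      v x 0 = 0 ∧ deriv (fun s => v x s) 0 = 0) ∧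
    (∀ (x : EuclideanSpace ℝ (Fin 3)) (t : ℝ), ‖x‖ = 1 → 0 < t →
      v x t = H x * ∫ τ in (0:ℝ)..t, ω τ * Qfun n (t + 1 - τ)) := by
  have hωc : Continuous ω := hω.continuous
  obtain ⟨P, hP, hHP⟩ := hHpoly
  obtain ⟨p, hp0, hQ, hode⟩ := exists_shifted_Qfun_polynomial n hn
  have hscale : ∀ (c : ℝ) (x : EuclideanSpace ℝ (Fin 3)), H (c • x) = c ^ n * H x := by
    intro c x
    rw [hHP, hHP]
    exact hP.eval_smul_eq c x
  have hconv : ∀ r t : ℝ, 0 < r →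
      ∫ τ in (0:ℝ)..(t + 1 - r), ω τ * Qfun n ((t + 1 - τ) / r) = polyConv ω p r (t + 1 - r) := by
    intro r t hr
    rw [polyConv]
    congr 1
    funext τ
    rw [← hQ]
    congr 2
    field_simp
    ring_nf
  have hform : ∀ (x : EuclideanSpace ℝ (Fin 3)) (t : ℝ), 0 < ‖x‖ → ‖x‖ - 1 < t →
      v x t = H x * ((‖x‖ ^ n)⁻¹ * polyConv ω p ‖x‖ (t + 1 - ‖x‖)) := by
    intro x t hx ht
    rw [hv, if_pos ht.le, hscale, hconv _ _ hx, inv_pow]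
    ring
  refine ⟨fun x t hx ht => ?_, fun x hx => ⟨?_, ?_⟩, fun x t hx ht => ?_⟩
  · have hr : 0 < ‖x‖ := by linarith
    have htime : iteratedDeriv 2 (fun s => v x s) t = H x * ((‖x‖ ^ n)⁻¹ *
        ((ω (t + 1 - ‖x‖) * (derivative p).eval 0 +
          polyConv ω (derivative (derivative p)) ‖x‖ (t + 1 - ‖x‖) / ‖x‖) / ‖x‖)) := by
      refine iteratedDeriv_two_eq ?_ ((((hasDerivAt_polyConv_time hωc (derivative p) hr.ne'
        t).div_const ‖x‖).const_mul _).const_mul _)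
      filter_upwards [lt_mem_nhds ht] with s hs
      have h := ((hasDerivAt_polyConv_time hωc p hr.ne' s).const_mul
        (‖x‖ ^ n)⁻¹).const_mul (H x)
      simp only [hp0, mul_zero, zero_add] at h
      refine h.congr_of_eventuallyEq ?_
      filter_upwards [lt_mem_nhds hs] with s hs
      exact hform x s hr hs
    set q := (X + 1) * derivative p with hq
    have hspace : lap3 (fun y => v y t) x = lap3 (fun y => H y *
        ((‖y‖ ^ n)⁻¹ * polyConv ω p ‖y‖ (t + 1 - ‖y‖))) x := by
      refine Finset.sum_congr rfl fun k _ => ?_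
      refine Filter.EventuallyEq.iteratedDeriv_eq 2 ?_
      have hc : Filter.Tendsto (fun s : ℝ => ‖x + s • EuclideanSpace.single k (1 : ℝ)‖) (nhds 0)
          (nhds ‖x‖) := by
        have : Continuous (fun s : ℝ => ‖x + s • EuclideanSpace.single k (1 : ℝ)‖) := by fun_prop
        simpa using this.tendsto 0
      filter_upwards [hc.eventually (lt_mem_nhds hr),
        hc.eventually (gt_mem_nhds (show ‖x‖ < t + 1 by linarith))] with s h1 h2
      exact hform _ t h1 (by linarith)
    have hF : ∀ r : ℝ, 0 < r → HasDerivAt (fun r => polyConv ω p r (t + 1 - r))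
        (-(polyConv ω q r (t + 1 - r) / r)) r := by
      intro r hr
      simpa [hp0] using hasDerivAt_polyConv_radius hωc p hr.ne' t
    have hpow : ∀ (m : ℕ) (r : ℝ), 0 < r →
        HasDerivAt (fun r : ℝ => (r ^ m)⁻¹) (-(m * (r ^ (m + 1))⁻¹)) r := by
      intro m r hr
      refine ((hasDerivAt_pow m r).fun_inv (pow_ne_zero m hr.ne')).congr_deriv ?_
      rcases m with _ | m
      · simp
      · simp
        field_simp
        ring
    have hf : ∀ᶠ r in nhds ‖x‖, HasDerivAt
        (fun r => (r ^ n)⁻¹ * polyConv ω p r (t + 1 - r))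
        (-(n * (r ^ (n + 1))⁻¹) * polyConv ω p r (t + 1 - r)
          + (r ^ n)⁻¹ * -(polyConv ω q r (t + 1 - r) / r)) r := by
      filter_upwards [lt_mem_nhds hr] with r hr
      exact (hpow n r hr).mul (hF r hr)
    have hf₁ := ((((hpow (n + 1) ‖x‖ hr).const_mul (n : ℝ)).fun_neg).fun_mul (hF ‖x‖ hr)).fun_add
      ((hpow n ‖x‖ hr).fun_mul (((hasDerivAt_polyConv_radius hωc q hr.ne' t).fun_div
        (hasDerivAt_id' ‖x‖) hr.ne').fun_neg))
    rw [hspace, htime, lap3_harmonic_mul_radial hP hHP hHharm (norm_pos_iff.1 hr) hf hf₁]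
    have hq0 : q.eval 0 = (derivative p).eval 0 := by simp [hq]
    have hqq : (X + 1) * derivative q =
        q + (derivative (derivative p) + C ((n : ℝ) * (n + 1)) * p) := by
      rw [← hode, hq]
      simp [derivative_mul]
      ring
    simp only [hqq, polyConv_add hωc, polyConv_C_mul, hq0]
    push_cast
    field_simp
    ring
  · rw [hv, if_neg (by linarith)]
  · have : (fun s => v x s) =ᶠ[nhds 0] fun _ => 0 := by
      filter_upwards [gt_mem_nhds (show (0 : ℝ) < ‖x‖ - 1 by linarith)] with s hs
      rw [hv, if_neg (by linarith)]
    rw [this.deriv_eq, deriv_const]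
  · rw [hv, if_pos (by linarith), hx]
    simp
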